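/- If in addition z₀ ≤ θ, then for every t ∈ {0, 1, 2, …}, E[Z(t)] ≤ θ + (1/r) log(1 + (e^{r δ_max} − ρ)/(1 − ρ)). -/

import Mathlib

open MeasureTheory

/-- A Bernstein-type bound on the exponential over `[-c, c]`. -/
theorem exp_le_one_add_add_sq_div {c y : ℝ} (hc1 : c ≤ 1) (hy : |y| ≤ c) :
    Real.exp y ≤ 1 + y + c ^ 2 / (2 * (1 - c / 3)) := by
  have hc0 : 0 ≤ c := (abs_nonneg y).trans hy
  have h := (abs_le.1 (Real.exp_bound (hy.trans hc1) (n := 4) (by norm_num))).2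
  norm_num [Finset.sum_range_succ, Nat.factorial] at h
  have h2 : y ^ 2 ≤ c ^ 2 := sq_le_sq' (abs_le.1 hy).1 (abs_le.1 hy).2
  have h3 : y ^ 3 ≤ c ^ 3 := by
    calc y ^ 3 ≤ |y| ^ 3 := by rw [← abs_pow]; exact le_abs_self _
      _ ≤ c ^ 3 := by gcongr
  have h4 : |y| ^ 4 ≤ c ^ 4 := by gcongr
  have hq : c ^ 2 / 2 + c ^ 3 / 6 + c ^ 4 / 18 ≤ c ^ 2 / (2 * (1 - c / 3)) := by
    rw [le_div_iff₀ (by linarith)]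
    nlinarith [pow_nonneg hc0 5]
  have hy4 : y ^ 4 = |y| ^ 4 := by rw [← abs_pow, abs_of_nonneg (by positivity)]
  have := pow_nonneg hc0 4
  nlinarith

/-- If the conditional expectation of `D` is at most `b` wherever the nonnegative
`m`-measurable weight `W` does not vanish, then `∫ W D ≤ b ∫ W`. -/
theorem integral_mul_le_of_condExp_le {Ω : Type*} {m m0 : MeasurableSpace Ω} {P : Measure Ω}
    [IsFiniteMeasure P] (hm : m ≤ m0) {W D : Ω → ℝ} {b : ℝ} (hW : StronglyMeasurable[m] W)
    (hW0 : ∀ x, 0 ≤ W x) (hWi : Integrable W P) (hD : Integrable D P)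
    (hWD : Integrable (fun x => W x * D x) P)
    (hb : ∀ᵐ x ∂P, W x ≠ 0 → (P[D | m]) x ≤ b) :
    ∫ x, W x * D x ∂P ≤ b * ∫ x, W x ∂P := by
  have hpull := condExp_mul_of_stronglyMeasurable_left hW hWD hD
  rw [← integral_condExp hm, ← integral_const_mul]
  refine integral_mono_ae integrable_condExp (hWi.const_mul b) ?_
  filter_upwards [hpull, hb] with x hx hbx
  refine hx.le.trans ?_
  by_cases h : W x = 0
  · simp [h]
  · rw [Pi.mul_apply, mul_comm b]
    exact mul_le_mul_of_nonneg_left (hbx h) (hW0 x)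

/-- A process with bounded increments started at a constant is bounded at each time. -/
theorem ae_abs_sub_le_of_bounded_increments {Ω : Type*} [MeasurableSpace Ω] {P : Measure Ω}
    {Z : ℕ → Ω → ℝ} {z0 δ : ℝ} (hZ0 : ∀ᵐ x ∂P, Z 0 x = z0)
    (hbdd : ∀ t : ℕ, ∀ᵐ x ∂P, |Z (t + 1) x - Z t x| ≤ δ) (t : ℕ) :
    ∀ᵐ x ∂P, |Z t x - z0| ≤ t * δ := by
  induction t with
  | zero => filter_upwards [hZ0] with x hx; simp [hx]
  | succ t ih =>
    filter_upwards [ih, hbdd t] with x h1 h2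
    have := abs_sub_le (Z (t + 1) x) (Z t x) z0
    push_cast
    linarith

/-- One step of the drift argument, in terms of exponential moments. -/
theorem integral_exp_drift_step {Ω : Type*} {m m0 : MeasurableSpace Ω} {P : Measure Ω}
    [IsProbabilityMeasure P] (hm : m ≤ m0) {X X' : Ω → ℝ} {θ δ β r : ℝ}
    (hX : Measurable[m] X) (hXi : Integrable X P) (hX'i : Integrable X' P)
    (hYi : Integrable (fun x => Real.exp (r * (X x - θ))) P)
    (hY'i : Integrable (fun x => Real.exp (r * (X' x - θ))) P)
    (hδ : 0 < δ) (hβ : 0 < β) (hβδ : β ≤ δ)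
    (hbdd : ∀ᵐ x ∂P, |X' x - X x| ≤ δ)
    (hdrift : ∀ᵐ x ∂P, θ ≤ X x → (P[fun y => X' y - X y | m]) x ≤ -β)
    (hr : r = β / (δ ^ 2 + δ * β / 3)) :
    ∫ x, Real.exp (r * (X' x - θ)) ∂P ≤
      (1 - r * β / 2) * ∫ x, Real.exp (r * (X x - θ)) ∂P
        + (Real.exp (r * δ) - (1 - r * β / 2)) := by
  have hr0 : 0 < r := by rw [hr]; positivity
  have hc1 : r * δ ≤ 1 := by
    rw [hr, div_mul_eq_mul_div, div_le_one (by positivity)]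
    nlinarith [mul_le_mul_of_nonneg_left hβδ hδ.le, mul_pos hδ hβ]
  have hquad : (r * δ) ^ 2 / (2 * (1 - r * δ / 3)) = r * β / 2 := by
    have h1 : 1 - r * δ / 3 = δ / (δ + β / 3) := by
      rw [hr]
      field_simp
      ring
    rw [h1, hr]
    field_simp
  have hρ0 : 0 ≤ 1 - r * β / 2 := by nlinarith [mul_le_mul_of_nonneg_left hβδ hr0.le]
  have hexp : 1 ≤ Real.exp (r * δ) := Real.one_le_exp (by positivity)
  have hρ1 : 0 < r * β := by positivity
  set Y : Ω → ℝ := fun x => Real.exp (r * (X x - θ)) with hY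
  set S : Set Ω := {x | θ ≤ X x} with hS
  have hSm : MeasurableSet[m] S := measurableSet_le measurable_const hX
  have hYm : Measurable[m] Y := Real.measurable_exp.comp ((hX.sub_const θ).const_mul r)
  set W : Ω → ℝ := S.indicator Y with hW
  have hWm : Measurable[m] W := hYm.indicator hSm
  have hWi : Integrable W P := hYi.indicator (hm _ hSm)
  have hW0 : ∀ x, 0 ≤ W x := fun x => Set.indicator_nonneg (fun y _ => (Real.exp_pos _).le) x
  have hD : Integrable (fun x => X' x - X x) P := hX'i.sub hXi
  have hWD : Integrable (fun x => W x * (X' x - X x)) P := by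
    refine hWi.mul_bdd (c := δ) hD.aestronglyMeasurable ?_
    filter_upwards [hbdd] with x hx using hx
  have hkey : ∫ x, W x * (X' x - X x) ∂P ≤ -β * ∫ x, W x ∂P := by
    refine integral_mul_le_of_condExp_le hm hWm.stronglyMeasurable hW0 hWi hD hWD ?_
    filter_upwards [hdrift] with x hx hne
    exact hx (Set.mem_of_indicator_ne_zero (s := S) (f := Y) hne)
  have hpt : ∀ᵐ x ∂P, Real.exp (r * (X' x - θ)) ≤
      (1 - r * β / 2) * Y x + r * β * W x + r * (W x * (X' x - X x))
        + (Real.exp (r * δ) - (1 - r * β / 2)) := by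
    filter_upwards [hbdd] with x hx
    have hsplit : Real.exp (r * (X' x - θ)) = Y x * Real.exp (r * (X' x - X x)) := by
      rw [hY, ← Real.exp_add]
      ring_nf
    have hYp : 0 < Y x := Real.exp_pos _
    rw [hsplit]
    by_cases hxS : x ∈ S
    · have hWx : W x = Y x := Set.indicator_of_mem hxS _
      have h := exp_le_one_add_add_sq_div (y := r * (X' x - X x)) hc1
        (by rw [abs_mul, abs_of_pos hr0]; gcongr)
      rw [hquad] at h
      have := mul_le_mul_of_nonneg_left h hYp.le
      rw [hWx]
      linarith
    · have hWx : W x = 0 := Set.indicator_of_notMem hxS _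
      have hlt : X x < θ := not_le.1 hxS
      have hY1 : Y x ≤ 1 := Real.exp_le_one_iff.2 (by nlinarith)
      have h : Real.exp (r * (X' x - X x)) ≤ Real.exp (r * δ) := by
        have := (abs_le.1 hx).2
        gcongr
      have := mul_le_mul_of_nonneg_left h hYp.le
      rw [hWx]
      nlinarith
  have hint1 := hYi.const_mul (1 - r * β / 2)
  have hint2 := hWi.const_mul (r * β)
  have hint3 := hWD.const_mul r
  have hint12 : Integrable (fun x => (1 - r * β / 2) * Y x + r * β * W x) P := hint1.add hint2
  have hint123 : Integrable (fun x =>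
      (1 - r * β / 2) * Y x + r * β * W x + r * (W x * (X' x - X x))) P := hint12.add hint3
  have hmono := integral_mono_ae hY'i (hint123.add (integrable_const _)) hpt
  simp only [Pi.add_apply] at hmono
  rw [integral_add hint123 (integrable_const _), integral_add hint12 hint3,
    integral_add hint1 hint2, integral_const_mul, integral_const_mul,
    integral_const_mul] at hmono
  simp only [integral_const, probReal_univ, one_smul] at hmono
  have := mul_le_mul_of_nonneg_left hkey hr0.le
  linarith

/-- Under the drift assumptions, if in addition `z₀ ≤ θ`, then for every `t`,
`E[Z(t)] ≤ θ + (1/r) log(1 + (e^{r δmax} − ρ)/(1 − ρ))`. -/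
theorem stmt6 {Ωs : Type*} [MeasurableSpace Ωs] (P : Measure Ωs) [IsProbabilityMeasure P]
    (Z : ℕ → Ωs → ℝ) (z0 θ δmax β r ρ : ℝ)
    (hmeas : ∀ t, Measurable (Z t))
    (hZ0 : ∀ᵐ x ∂P, Z 0 x = z0)
    (hδ : 0 < δmax) (hβ : 0 < β) (hβδ : β ≤ δmax)
    (hbdd : ∀ t : ℕ, ∀ᵐ x ∂P, |Z (t + 1) x - Z t x| ≤ δmax)
    (hdrift : ∀ t : ℕ, ∀ᵐ x ∂P, θ ≤ Z t x →
      (P[fun y => Z (t + 1) y - Z t y |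
        ⨆ i ∈ Finset.range (t + 1), MeasurableSpace.comap (Z i) inferInstance]) x ≤ -β)
    (hr : r = β / (δmax ^ 2 + δmax * β / 3)) (hρ : ρ = 1 - r * β / 2)
    (hz0θ : z0 ≤ θ) :
    ∀ t : ℕ, ∫ x, Z t x ∂P ≤
      θ + (1 / r) * Real.log (1 + (Real.exp (r * δmax) - ρ) / (1 - ρ)) := by
  have hr0 : 0 < r := by rw [hr]; positivity
  have hZb := ae_abs_sub_le_of_bounded_increments hZ0 hbdd
  have hZi : ∀ t, Integrable (Z t) P := fun t => by
    refine Integrable.of_bound (hmeas t).aestronglyMeasurable (t * δmax + |z0|) ?_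
    filter_upwards [hZb t] with x hx
    have := abs_add_le (Z t x - z0) z0
    rw [sub_add_cancel] at this
    rw [Real.norm_eq_abs]
    linarith
  have hYi : ∀ t, Integrable (fun x => Real.exp (r * (Z t x - θ))) P := fun t => by
    refine Integrable.of_bound
      (Real.measurable_exp.comp (((hmeas t).sub_const θ).const_mul r)).aestronglyMeasurable
      (Real.exp (r * (t * δmax + z0 - θ))) ?_
    filter_upwards [hZb t] with x hx
    have := (abs_le.1 hx).2
    rw [Real.norm_eq_abs, Real.abs_exp]
    gcongr
    linarith
  have hρ1 : 0 < 1 - ρ := by rw [hρ]; linarith [mul_pos hr0 hβ]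
  have hK : 0 < (Real.exp (r * δmax) - ρ) / (1 - ρ) := by
    have := Real.one_le_exp (mul_pos hr0 hδ).le
    exact div_pos (by linarith) hρ1
  have hρ0 : 0 ≤ ρ := by
    have : r * δmax ≤ 1 := by
      rw [hr, div_mul_eq_mul_div, div_le_one (by positivity)]
      nlinarith [mul_le_mul_of_nonneg_left hβδ hδ.le, mul_pos hδ hβ]
    nlinarith [mul_le_mul_of_nonneg_left hβδ hr0.le]
  set K := (Real.exp (r * δmax) - ρ) / (1 - ρ) with hKdef
  have hKeq : Real.exp (r * δmax) - ρ = K * (1 - ρ) := by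
    rw [hKdef, div_mul_cancel₀ _ hρ1.ne']
  have hmoment : ∀ t, ∫ x, Real.exp (r * (Z t x - θ)) ∂P ≤ 1 + K := by
    intro t
    induction t with
    | zero =>
      have h : ∫ x, Real.exp (r * (Z 0 x - θ)) ∂P ≤ ∫ _, (1 : ℝ) ∂P := by
        refine integral_mono_ae (hYi 0) (integrable_const _) ?_
        filter_upwards [hZ0] with x hx
        rw [hx]
        exact Real.exp_le_one_iff.2 (by nlinarith)
      simp only [integral_const, probReal_univ, one_smul] at h
      linarith
    | succ t ih =>
      have hle : (⨆ i ∈ Finset.range (t + 1),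
          MeasurableSpace.comap (Z i) inferInstance) ≤ ‹MeasurableSpace Ωs› :=
        iSup₂_le fun i _ => (hmeas i).comap_le
      have hZt : Measurable[⨆ i ∈ Finset.range (t + 1),
          MeasurableSpace.comap (Z i) inferInstance] (Z t) :=
        measurable_iff_comap_le.2 (le_iSup₂_of_le t (Finset.self_mem_range_succ t) le_rfl)
      have h := integral_exp_drift_step hle hZt (hZi t) (hZi (t + 1)) (hYi t) (hYi (t + 1))
        hδ hβ hβδ (hbdd t) (hdrift t) hr
      rw [← hρ, hKeq] at h
      have := mul_le_mul_of_nonneg_left ih hρ0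
      linarith
  intro t
  have hM : 0 < 1 + K := by linarith
  have hlin : ∫ x, r * (Z t x - θ) ∂P ≤
      ∫ x, (Real.exp (r * (Z t x - θ)) / (1 + K) + (Real.log (1 + K) - 1)) ∂P := by
    refine integral_mono (((hZi t).sub (integrable_const θ)).const_mul r)
      (((hYi t).div_const _).add (integrable_const _)) fun x => ?_
    have h := Real.log_le_sub_one_of_pos
      (div_pos (Real.exp_pos (r * (Z t x - θ))) hM)
    rw [Real.log_div (Real.exp_ne_zero _) hM.ne', Real.log_exp] at h
    dsimp only
    linarith
  rw [integral_const_mul, integral_sub (hZi t) (integrable_const _),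
    integral_add ((hYi t).div_const _) (integrable_const _), integral_div] at hlin
  simp only [integral_const, probReal_univ, one_smul] at hlin
  have hdiv : (∫ x, Real.exp (r * (Z t x - θ)) ∂P) / (1 + K) ≤ 1 :=
    (div_le_one hM).2 (hmoment t)
  have hfin : ∫ x, Z t x ∂P - θ ≤ Real.log (1 + K) / r := by
    rw [le_div_iff₀ hr0]
    linarith
  rw [one_div, inv_mul_eq_div]
  linarith
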